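/- For every finite connected simple port-labeled graph G with n vertices, every root vertex v_R, and every integer k with 2 ≤ k ≤ n: suppose v_i (with i < s) is a rootpath vertex and the k-stopped port-DFS traversal leaves v_i via its child port port(v_i, v_{i+1}) with direction forward at move t. Then at every later move t' (up to and including the halting of the k-stopped traversal) at which the walk arrives at v_i, its direction is forward. -/

import Mathlib

open scoped Classical

/-- Direction of a move of the port-DFS traversal. -/
inductive PDir : Type where
  | fwd : PDir
  | bwd : PDir
deriving DecidableEq

/-- Position of the port-DFS walk: before the first move (`start`, at the root),
having just arrived at `cur` via in-port `inPort` with direction `dir` (`moving`),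
or halted at a vertex. -/
inductive PPos (V : Type) : Type where
  | start : PPos V
  | moving : V → ℕ → PDir → PPos V
  | halted : V → PPos V

/-- Full state of the port-DFS traversal: position, set `S` of visited vertices,
and parent-port assignment `par`. -/
structure PState (V : Type) : Type where
  pos : PPos V
  vis : Finset V
  par : V → ℕ

/-- A finite connected simple port-labeled graph: for every vertex `u` of degree
`deg u`, the edges incident to `u` are labeled by distinct ports `0, …, deg u - 1`;
`port u v` is the port at `u` of the edge `{u, v}`. -/
structure PortedGraph (V : Type) [Fintype V] [DecidableEq V] : Type where
  G : SimpleGraph V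
  conn : G.Connected
  deg : V → ℕ
  port : V → V → ℕ
  port_lt : ∀ {u v : V}, G.Adj u v → port u v < deg u
  port_inj : ∀ {u v w : V}, G.Adj u v → G.Adj u w → port u v = port u w → v = w
  port_surj : ∀ {u : V} (p : ℕ), p < deg u → ∃ v : V, G.Adj u v ∧ port u v = p

namespace PortedGraph

variable {V : Type} [Fintype V] [DecidableEq V]

/-- The neighbor of `u` reached from `u` through port `p`. -/
noncomputable def dest (P : PortedGraph V) (u : V) (p : ℕ) : V :=
  if h : ∃ v : V, P.G.Adj u v ∧ P.port u v = p then h.choose else u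

/-- One step of the port-DFS traversal from root `vR`.  A state with
`pos = moving v q d` means the walk has just arrived at `v` via port `q` (at `v`)
with direction `d`, and `vis`/`par` are the data from before processing this
arrival; the step processes the arrival according to rules (i)–(v) and performs
the next move (or halts). -/
noncomputable def step (P : PortedGraph V) (vR : V) (s : PState V) : PState V :=
  match s.pos with
  | PPos.start =>
      if 0 < P.deg vR then
        { pos := PPos.moving (P.dest vR 0) (P.port (P.dest vR 0) vR) PDir.fwd,
          vis := s.vis, par := s.par }
      else
        { pos := PPos.halted vR, vis := s.vis, par := s.par }
  | PPos.halted v => { pos := PPos.halted v, vis := s.vis, par := s.par }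
  | PPos.moving v q PDir.fwd =>
      if v ∈ s.vis then
        -- rule (ii): leave via `q` with direction backward
        { pos := PPos.moving (P.dest v q) (P.port (P.dest v q) v) PDir.bwd,
          vis := s.vis, par := s.par }
      else
        -- rule (i): add `v` to `S`, set `par v := q`, leave via `(q+1) % deg v`
        { pos := PPos.moving (P.dest v ((q + 1) % P.deg v))
            (P.port (P.dest v ((q + 1) % P.deg v)) v)
            (if (q + 1) % P.deg v = q then PDir.bwd else PDir.fwd),
          vis := insert v s.vis, par := Function.update s.par v q }
  | PPos.moving v q PDir.bwd =>
      if v ≠ vR ∧ (q + 1) % P.deg v = s.par v then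
        -- rule (iii): leave via the parent port with direction backward
        { pos := PPos.moving (P.dest v (s.par v)) (P.port (P.dest v (s.par v)) v) PDir.bwd,
          vis := s.vis, par := s.par }
      else if v = vR ∧ (q + 1) % P.deg v = 0 then
        -- rule (iv): halt
        { pos := PPos.halted v, vis := s.vis, par := s.par }
      else
        -- rule (v): leave via `(q+1) % deg v` with direction forward
        { pos := PPos.moving (P.dest v ((q + 1) % P.deg v))
            (P.port (P.dest v ((q + 1) % P.deg v)) v) PDir.fwd,
          vis := s.vis, par := s.par }

/-- The trace of the port-DFS traversal from `vR`:  `trace P vR t` is the state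
after `t` transitions; every transition except those into/out of a halted
position is a move along an edge. -/
noncomputable def trace (P : PortedGraph V) (vR : V) : ℕ → PState V
  | 0 => { pos := PPos.start, vis := {vR}, par := fun _ => 0 }
  | t + 1 => P.step vR (P.trace vR t)

/-- The first time at which `k` distinct vertices have been visited; the
`k`-stopped traversal is the traversal halted at that moment (at which point the
walk, having made `stopTime - 1` moves, stands at the `k`-th visited vertex). -/
noncomputable def stopTime (P : PortedGraph V) (vR : V) (k : ℕ) : ℕ :=
  sInf {t : ℕ | k ≤ ((P.trace vR t).vis).card}

/-- `V'`: the set of vertices visited by the `k`-stopped traversal. -/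
noncomputable def visitedBy (P : PortedGraph V) (vR : V) (k : ℕ) : Finset V :=
  (P.trace vR (P.stopTime vR k)).vis

/-- `V'` as a set. -/
noncomputable def Vset (P : PortedGraph V) (vR : V) (k : ℕ) : Set V :=
  ↑(P.visitedBy vR k)

/-- The parent-port assignment at the end of the `k`-stopped traversal. -/
noncomputable def parFinal (P : PortedGraph V) (vR : V) (k : ℕ) : V → ℕ :=
  (P.trace vR (P.stopTime vR k)).par

/-- `u(v)`: the neighbor of `v` reached from `v` through its parent port. -/
noncomputable def parentVert (P : PortedGraph V) (vR : V) (k : ℕ) (v : V) : V :=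
  P.dest v (P.parFinal vR k v)

/-- `v_L`: the `k`-th (last) vertex added to `S` by the `k`-stopped traversal. -/
noncomputable def lastVert (P : PortedGraph V) (vR : V) (k : ℕ) : V :=
  if h : ∃ v : V, v ∈ P.visitedBy vR k ∧ v ∉ (P.trace vR (P.stopTime vR k - 1)).vis
  then h.choose else vR

/-- The tree `T` of parent edges `{v, u(v)}`, `v ∈ V' \ {v_R}`, as a graph on `V`
(vertices outside `V'` are isolated). -/
noncomputable def treeRel (P : PortedGraph V) (vR : V) (k : ℕ) : SimpleGraph V :=
  SimpleGraph.fromRel (fun a b =>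
    a ∈ P.visitedBy vR k ∧ a ≠ vR ∧ b = P.parentVert vR k a)

/-- The tree `T` of parent edges as a graph on the vertex set `V'`. -/
noncomputable def treeSub (P : PortedGraph V) (vR : V) (k : ℕ) :
    SimpleGraph (P.Vset vR k) :=
  SimpleGraph.fromRel (fun a b => (a : V) ≠ vR ∧ (b : V) = P.parentVert vR k (a : V))

/-- `v` lies on the rootpath: the unique path in `T` from `v_R` to `v_L`. -/
def onRootpath (P : PortedGraph V) (vR : V) (k : ℕ) (v : V) : Prop :=
  ∃ p : (P.treeRel vR k).Walk vR (P.lastVert vR k), p.IsPath ∧ v ∈ p.support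

/-- The move made out of state `s`:  `some (v, p, d)` if the walk leaves vertex
`v` via port `p` with direction `d`, and `none` if it halts (or already halted). -/
noncomputable def exitEvent (P : PortedGraph V) (vR : V) (s : PState V) :
    Option (V × ℕ × PDir) :=
  match s.pos with
  | PPos.start => if 0 < P.deg vR then some (vR, 0, PDir.fwd) else none
  | PPos.halted _ => none
  | PPos.moving v q PDir.fwd =>
      if v ∈ s.vis then some (v, q, PDir.bwd)
      else some (v, (q + 1) % P.deg v,
        if (q + 1) % P.deg v = q then PDir.bwd else PDir.fwd)
  | PPos.moving v q PDir.bwd =>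
      if v ≠ vR ∧ (q + 1) % P.deg v = s.par v then some (v, s.par v, PDir.bwd)
      else if v = vR ∧ (q + 1) % P.deg v = 0 then none
      else some (v, (q + 1) % P.deg v, PDir.fwd)

end PortedGraph

namespace SimpleGraph.Walk

/-- In a graph all of whose edges join a non-root vertex to its parent, a path to the root
is followed by the parent of each of its non-root vertices. -/
theorem IsPath.parent_mem_support_tail {V : Type} {G : SimpleGraph V} {r : V} {f : V → V}
    (hG : ∀ a b, G.Adj a b → (a ≠ r ∧ b = f a) ∨ (b ≠ r ∧ a = f b))
    {a : V} {p : G.Walk a r} (hp : p.IsPath) :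
    ∀ x ∈ p.support, x ≠ r → f x ∈ p.support.tail := by
  induction p with
  | nil => simp
  | @cons a b c h p ih =>
    rw [cons_isPath_iff] at hp
    have ih := ih hG hp.1
    intro x hx hxr
    rw [support_cons, List.tail_cons]
    rw [support_cons, List.mem_cons] at hx
    rcases hx with rfl | hx
    · rcases hG _ _ h with ⟨-, hb⟩ | ⟨hb, ha⟩
      · exact hb ▸ p.start_mem_support
      · exact absurd (ha ▸ List.mem_of_mem_tail (ih b p.start_mem_support hb)) hp.2
    · exact List.mem_of_mem_tail (ih x hx hxr)

/-- In a graph all of whose edges join a non-root vertex to its parent, a path to the root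
stays in every parent-closed set containing its start. -/
theorem IsPath.support_subset_of_parent_closed {V : Type} {G : SimpleGraph V} {r : V}
    {f : V → V} (hG : ∀ a b, G.Adj a b → (a ≠ r ∧ b = f a) ∨ (b ≠ r ∧ a = f b))
    {S : Set V} (hS : ∀ x ∈ S, x ≠ r → f x ∈ S)
    {a : V} {p : G.Walk a r} (hp : p.IsPath) (ha : a ∈ S) : ∀ x ∈ p.support, x ∈ S := by
  induction p with
  | nil => simpa using ha
  | @cons a b c h p ih =>
    rw [cons_isPath_iff] at hp
    have hb : b ∈ S := by
      rcases hG _ _ h with ⟨har, hb⟩ | ⟨hb, hab⟩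
      · exact hb ▸ hS a ha har
      · exact absurd (hab ▸ List.mem_of_mem_tail
          (hp.1.parent_mem_support_tail hG b p.start_mem_support hb)) hp.2
    intro x hx
    rw [support_cons, List.mem_cons] at hx
    rcases hx with rfl | hx
    · exact ha
    · exact ih hG hS hp.1 hb x hx

end SimpleGraph.Walk

namespace PortedGraph

variable {V : Type} [Fintype V] [DecidableEq V]

theorem dest_spec (P : PortedGraph V) {u : V} {p : ℕ} (hp : p < P.deg u) :
    P.G.Adj u (P.dest u p) ∧ P.port u (P.dest u p) = p := by
  have h := P.port_surj p hp
  rw [dest, dif_pos h]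
  exact h.choose_spec

theorem dest_port (P : PortedGraph V) {u v : V} (h : P.G.Adj u v) :
    P.dest u (P.port u v) = v := by
  have hs := P.dest_spec (P.port_lt h)
  exact P.port_inj hs.1 h hs.2

theorem deg_pos (P : PortedGraph V) {u v : V} (h : P.G.Adj u v) : 0 < P.deg u :=
  (Nat.zero_le _).trans_lt (P.port_lt h)

/-- `l` lists a chain of parents from its head down to the root. -/
inductive IsStack (P : PortedGraph V) (vR : V) (par : V → ℕ) : List V → Prop
  | root : IsStack P vR par [vR]
  | push {x u : V} {l : List V} : x ≠ vR → x ∉ u :: l → P.G.Adj x u → par x = P.port x u →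
      IsStack P vR par (u :: l) → IsStack P vR par (x :: u :: l)

theorem IsStack.congr {P : PortedGraph V} {vR : V} {par par' : V → ℕ} {l : List V}
    (h : P.IsStack vR par l) (hpar : ∀ x ∈ l, par' x = par x) : P.IsStack vR par' l := by
  induction h with
  | root => exact .root
  | push h1 h2 h3 h4 _ ih =>
    exact .push h1 h2 h3 ((hpar _ (by simp)).trans h4)
      (ih fun y hy => hpar y (List.mem_cons_of_mem _ hy))

theorem IsStack.root_mem {P : PortedGraph V} {vR : V} {par : V → ℕ} {l : List V}
    (h : P.IsStack vR par l) : vR ∈ l := by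
  induction h with
  | root => simp
  | push _ _ _ _ _ ih => exact List.mem_cons_of_mem _ ih

theorem IsStack.parent_mem_tail {P : PortedGraph V} {vR : V} {par : V → ℕ} {l : List V}
    (h : P.IsStack vR par l) :
    ∀ x ∈ l, x ≠ vR → P.G.Adj x (P.dest x (par x)) ∧ P.dest x (par x) ∈ l.tail := by
  induction h with
  | root => simp
  | push h1 h2 h3 h4 _ ih =>
    intro y hy hyR
    rcases List.mem_cons.1 hy with rfl | hy
    · rw [h4, P.dest_port h3]
      exact ⟨h3, by simp⟩
    · exact (ih y hy hyR).imp_right List.mem_of_mem_tail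

theorem IsStack.head_notMem {P : PortedGraph V} {vR : V} {par : V → ℕ} {u : V} {l : List V}
    (h : P.IsStack vR par (u :: l)) : u ∉ l := by
  cases h with
  | root => simp
  | push _ h2 => exact h2

/-- The vertex `u` controls the traversal at the given position: it is the vertex where the
walk stands, or the sender of the forward move that has just been made. -/
def Controls (P : PortedGraph V) (vR u : V) : PPos V → Prop
  | .start => u = vR
  | .halted v => u = v
  | .moving v _ .bwd => u = v ∧ 0 < P.deg v
  | .moving v q .fwd => P.G.Adj v u ∧ q = P.port v u

/-- `u :: l` is the depth-first search stack of the state `s`. -/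
structure HasStack (P : PortedGraph V) (vR : V) (s : PState V) (u : V) (l : List V) : Prop where
  isStack : P.IsStack vR s.par (u :: l)
  mem_vis : ∀ x ∈ u :: l, x ∈ s.vis
  controls : P.Controls vR u s.pos

theorem controls_fwd (P : PortedGraph V) (vR : V) {u : V} {p : ℕ} (hp : p < P.deg u) :
    P.Controls vR u (.moving (P.dest u p) (P.port (P.dest u p) u) .fwd) :=
  ⟨(P.dest_spec hp).1.symm, rfl⟩

theorem controls_bwd (P : PortedGraph V) (vR : V) {x u : V} (h : P.G.Adj x u) (p : ℕ) :
    P.Controls vR u (.moving u p .bwd) :=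
  ⟨rfl, P.deg_pos h.symm⟩

theorem HasStack.step {P : PortedGraph V} {vR : V} {s : PState V} {u : V} {l : List V}
    (h : P.HasStack vR s u l) :
    ∃ u' l', P.HasStack vR (P.step vR s) u' l' ∧ ∀ x ∈ u' :: l', x ∈ s.vis → x ∈ u :: l := by
  obtain ⟨hst, hvis, hc⟩ := h
  rcases s with ⟨pos, vis, par⟩
  match pos with
  | .start =>
    obtain rfl : u = vR := hc
    refine ⟨u, l, ?_, fun x hx _ => hx⟩
    by_cases hd : 0 < P.deg u
    · simp only [PortedGraph.step, if_pos hd]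
      exact ⟨hst, hvis, P.controls_fwd _ hd⟩
    · simp only [PortedGraph.step, if_neg hd]
      exact ⟨hst, hvis, rfl⟩
  | .halted v => exact ⟨u, l, ⟨hst, hvis, hc⟩, fun x hx _ => hx⟩
  | .moving x q .fwd =>
    obtain ⟨hadj, rfl⟩ := hc
    by_cases hx : x ∈ vis
    · refine ⟨u, l, ?_, fun x hx _ => hx⟩
      simp only [PortedGraph.step, if_pos hx, P.dest_port hadj]
      exact ⟨hst, hvis, P.controls_bwd _ hadj _⟩
    · have hne : ∀ y ∈ u :: l, y ≠ x := fun y hy h => hx (h ▸ hvis y hy)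
      have hst' : P.IsStack vR (Function.update par x (P.port x u)) (u :: l) :=
        hst.congr fun y hy => Function.update_of_ne (hne y hy) _ _
      by_cases hd : (P.port x u + 1) % P.deg x = P.port x u
      · refine ⟨u, l, ?_, fun x hx _ => hx⟩
        simp only [PortedGraph.step, if_neg hx, if_pos hd]
        simp only [hd, P.dest_port hadj]
        exact ⟨hst', fun y hy => Finset.mem_insert_of_mem (hvis y hy), P.controls_bwd _ hadj _⟩
      · refine ⟨x, u :: l, ?_, fun y hy hyv => ?_⟩
        · simp only [PortedGraph.step, if_neg hx, if_neg hd]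
          refine ⟨.push (hne _ hst.root_mem).symm (fun h => hne x h rfl) hadj
            (Function.update_self ..) hst', fun y hy => ?_,
            P.controls_fwd _ (Nat.mod_lt _ (P.deg_pos hadj))⟩
          rcases List.mem_cons.1 hy with rfl | hy
          · exact Finset.mem_insert_self _ _
          · exact Finset.mem_insert_of_mem (hvis y hy)
        · rcases List.mem_cons.1 hy with rfl | hy
          · exact absurd hyv hx
          · exact hy
  | .moving v q .bwd =>
    obtain ⟨rfl, hdeg⟩ := hc
    by_cases h3 : u ≠ vR ∧ (q + 1) % P.deg u = par u
    · simp only [PortedGraph.step, if_pos h3]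
      cases hst with
      | root => exact absurd rfl h3.1
      | @push _ w l' h1 h2 hadj hpar htail =>
        refine ⟨w, l', ?_, fun x hx _ => List.mem_cons_of_mem _ hx⟩
        have hpar : par u = P.port u w := hpar
        simp only [hpar, P.dest_port hadj]
        exact ⟨htail, fun y hy => hvis y (List.mem_cons_of_mem _ hy), P.controls_bwd _ hadj _⟩
    · refine ⟨u, l, ?_, fun x hx _ => hx⟩
      by_cases h4 : u = vR ∧ (q + 1) % P.deg u = 0
      · simp only [PortedGraph.step, if_neg h3, if_pos h4]
        exact ⟨hst, hvis, rfl⟩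
      · simp only [PortedGraph.step, if_neg h3, if_neg h4]
        exact ⟨hst, hvis, P.controls_fwd _ (Nat.mod_lt _ hdeg)⟩

theorem step_extends (P : PortedGraph V) (vR : V) (s : PState V) :
    s.vis ⊆ (P.step vR s).vis ∧ ∀ x ∈ s.vis, (P.step vR s).par x = s.par x := by
  rcases s with ⟨pos, vis, par⟩
  match pos with
  | .start => simp only [step]; split_ifs <;> simp
  | .halted v => simp [step]
  | .moving x q .bwd => simp only [step]; split_ifs <;> simp
  | .moving x q .fwd =>
    by_cases hx : x ∈ vis
    · simp [step, hx]
    · simp only [step, if_neg hx]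
      exact ⟨Finset.subset_insert _ _,
        fun y hy => Function.update_of_ne (ne_of_mem_of_not_mem hy hx) _ _⟩

/-- A step that visits a new vertex is a forward arrival there. -/
theorem exists_of_step_vis_ne (P : PortedGraph V) (vR : V) {s : PState V}
    (h : (P.step vR s).vis ≠ s.vis) :
    ∃ x q, s.pos = .moving x q .fwd ∧ x ∉ s.vis ∧ (P.step vR s).vis = insert x s.vis ∧
      (P.step vR s).par = Function.update s.par x q := by
  rcases s with ⟨pos, vis, par⟩
  match pos with
  | .start => simp only [step] at h; split_ifs at h <;> exact absurd rfl h
  | .halted v => exact absurd rfl h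
  | .moving x q .bwd => simp only [step] at h; split_ifs at h <;> exact absurd rfl h
  | .moving x q .fwd =>
    by_cases hx : x ∈ vis
    · simp [step, hx] at h
    · exact ⟨x, q, rfl, hx, by simp [step, hx], by simp [step, hx]⟩

theorem step_pos_of_exitEvent (P : PortedGraph V) (vR : V) {s : PState V} {v : V} {p : ℕ}
    {d : PDir} (h : P.exitEvent vR s = some (v, p, d)) :
    (P.step vR s).pos = .moving (P.dest v p) (P.port (P.dest v p) v) d := by
  rcases s with ⟨pos, vis, par⟩
  match pos with
  | .start =>
    simp only [exitEvent] at h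
    split_ifs at h with h1
    cases h
    simp only [step, if_pos h1]
  | .halted v => simp [exitEvent] at h
  | .moving x q .fwd =>
    by_cases h1 : x ∈ vis
    · simp only [exitEvent, if_pos h1] at h
      cases h
      simp only [step, if_pos h1]
    · simp only [exitEvent, if_neg h1] at h
      cases h
      simp only [step, if_neg h1]
  | .moving x q .bwd =>
    simp only [exitEvent] at h
    split_ifs at h with h1 h2
    · cases h
      simp only [step, if_pos h1]
    · cases h
      simp only [step, if_neg h1, if_neg h2]

theorem mem_step_vis (P : PortedGraph V) (vR : V) {s : PState V} {v : V} {q : ℕ}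
    (h : s.pos = .moving v q .fwd) : v ∈ (P.step vR s).vis := by
  rcases s with ⟨pos, vis, par⟩
  obtain rfl : pos = _ := h
  by_cases hv : v ∈ vis <;> simp [step, hv]

theorem trace_extends (P : PortedGraph V) (vR : V) {a b : ℕ} (hab : a ≤ b) :
    (P.trace vR a).vis ⊆ (P.trace vR b).vis ∧
      ∀ x ∈ (P.trace vR a).vis, (P.trace vR b).par x = (P.trace vR a).par x := by
  induction b, hab using Nat.le_induction with
  | base => simp
  | succ b _ ih =>
    have h := P.step_extends vR (P.trace vR b)
    exact ⟨ih.1.trans h.1, fun x hx => (h.2 x (ih.1 hx)).trans (ih.2 x hx)⟩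

theorem exists_hasStack (P : PortedGraph V) (vR : V) (t : ℕ) :
    ∃ u l, P.HasStack vR (P.trace vR t) u l := by
  induction t with
  | zero => exact ⟨vR, [], .root, by simp [trace], rfl⟩
  | succ t ih =>
    obtain ⟨u, l, h⟩ := ih
    obtain ⟨u₁, l₁, h₁, -⟩ := h.step
    exact ⟨u₁, l₁, h₁⟩

/-- A visited vertex that has left the stack never returns to it. -/
theorem HasStack.later {P : PortedGraph V} {vR : V} {a b : ℕ} (hab : a ≤ b) {u : V} {l : List V}
    (h : P.HasStack vR (P.trace vR a) u l) :
    ∃ u' l', P.HasStack vR (P.trace vR b) u' l' ∧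
      ∀ x ∈ u' :: l', x ∈ (P.trace vR a).vis → x ∈ u :: l := by
  induction b, hab using Nat.le_induction with
  | base => exact ⟨u, l, h, fun x hx _ => hx⟩
  | succ b hab ih =>
    obtain ⟨u₁, l₁, h₁, hs₁⟩ := ih
    obtain ⟨u₂, l₂, h₂, hs₂⟩ := h₁.step
    exact ⟨u₂, l₂, h₂, fun x hx hxv => hs₁ x (hs₂ x hx ((P.trace_extends vR hab).1 hxv)) hxv⟩

/-- The stopping move is a forward arrival at the last vertex, which is new. -/
theorem stopTime_arrival (P : PortedGraph V) (vR : V) {k T : ℕ}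
    (hT : P.stopTime vR k = T + 1) :
    ∃ q, (P.trace vR T).pos = .moving (P.lastVert vR k) q .fwd ∧
      P.lastVert vR k ∉ (P.trace vR T).vis ∧
      P.parFinal vR k = Function.update (P.trace vR T).par (P.lastVert vR k) q := by
  have hne : {t : ℕ | k ≤ ((P.trace vR t).vis).card}.Nonempty := by
    by_contra h
    rw [Set.not_nonempty_iff_eq_empty] at h
    simp [stopTime, h] at hT
  have h1 : k ≤ ((P.trace vR (T + 1)).vis).card := hT ▸ Nat.sInf_mem hne
  have h2 : ¬ k ≤ ((P.trace vR T).vis).card := fun h => by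
    have : P.stopTime vR k ≤ T := Nat.sInf_le h
    omega
  obtain ⟨x, q, hpos, hx, hvis, hpar⟩ := P.exists_of_step_vis_ne vR (s := P.trace vR T)
    fun h => h2 (h ▸ h1)
  have hex : ∃ v, v ∈ P.visitedBy vR k ∧ v ∉ (P.trace vR (P.stopTime vR k - 1)).vis := by
    refine ⟨x, ?_, by simpa [hT] using hx⟩
    simp only [visitedBy, hT, trace, hvis, Finset.mem_insert_self]
  have hlast : P.lastVert vR k = x := by
    have huniq : ∀ y, y ∈ P.visitedBy vR k ∧ y ∉ (P.trace vR (P.stopTime vR k - 1)).vis →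
        y = x := by
      rintro y ⟨hy, hy'⟩
      simp only [visitedBy, hT, trace, hvis, Nat.add_sub_cancel] at hy hy'
      exact (Finset.mem_insert.1 hy).resolve_right hy'
    rw [lastVert, dif_pos hex]
    exact huniq _ hex.choose_spec
  rw [hlast]
  exact ⟨q, hpos, hx, by rw [parFinal, hT]; exact hpar⟩

theorem treeRel_adj (P : PortedGraph V) (vR : V) (k : ℕ) (a b : V)
    (h : (P.treeRel vR k).Adj a b) :
    (a ≠ vR ∧ b = P.parentVert vR k a) ∨ (b ≠ vR ∧ a = P.parentVert vR k b) := by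
  simp only [treeRel, SimpleGraph.fromRel_adj] at h
  tauto

end PortedGraph

/-- for every `2 ≤ k ≤ n`, if `v = v_i` (with `i < s`) is a rootpath
vertex with successor `w = v_{i+1}` on the rootpath (characterized as: `w` is on
the rootpath, adjacent to `v` in `T`, and `v` lies on the unique path in `T` from
`v_R` to `w`), and the `k`-stopped port-DFS traversal leaves `v` via its child
port `port(v, w)` with direction forward at move `t`, then at every later move
`t'` of the `k`-stopped traversal at which the walk arrives at `v`, its direction
is forward. -/
theorem statement8 {V : Type} [Fintype V] [DecidableEq V]
    (P : PortedGraph V) (vR : V) (k : ℕ)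
    (hk1 : 2 ≤ k) (hk2 : k ≤ Fintype.card V)
    (v w : V) (hv : P.onRootpath vR k v) (hvL : v ≠ P.lastVert vR k)
    (hw : P.onRootpath vR k w) (hadj : (P.treeRel vR k).Adj v w)
    (hanc : ∀ p : (P.treeRel vR k).Walk vR w, p.IsPath → v ∈ p.support)
    (t : ℕ) (ht1 : 1 ≤ t) (ht2 : t ≤ P.stopTime vR k - 1)
    (hleave : P.exitEvent vR (P.trace vR (t - 1))
      = some (v, P.port v w, PDir.fwd)) :
    ∀ t' : ℕ, t < t' → t' ≤ P.stopTime vR k - 1 →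
      ∀ (q : ℕ) (d : PDir), (P.trace vR t').pos = PPos.moving v q d →
        d = PDir.fwd := by
  intro t' htt' ht' q d hpos
  obtain ⟨T, hT⟩ : ∃ T, P.stopTime vR k = T + 1 := ⟨P.stopTime vR k - 1, by omega⟩
  have htT' : t' ≤ T := by omega
  obtain ⟨qL, hposL, hL, hparL⟩ := P.stopTime_arrival vR hT
  have hG := P.treeRel_adj vR k
  cases d with
  | fwd => rfl
  | bwd =>
  exfalso
  -- The parent of `w` is `v`.
  obtain ⟨pw, hpw, hwmem⟩ := hw
  have hwv : w ≠ vR ∧ v = P.parentVert vR k w := by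
    rcases hG v w hadj with ⟨hvR, hwp⟩ | h
    · have hpath := (hpw.takeUntil hwmem).reverse
      have hvmem := hanc _ (hpw.takeUntil hwmem)
      have hmem := hpath.parent_mem_support_tail hG v
        (by simpa using hvmem) hvR
      have hnd := hpath.support_nodup
      rw [← SimpleGraph.Walk.cons_tail_support, List.nodup_cons] at hnd
      exact absurd (hwp ▸ hmem) hnd.1
    · exact h
  obtain ⟨hwR, hvw⟩ := hwv
  obtain ⟨u₁, l₁, hs₁⟩ := P.exists_hasStack vR t'
  obtain ⟨u₂, l₂, hs₂, hback⟩ := hs₁.later htT'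
  have hc₁ := hs₁.controls
  rw [hpos] at hc₁
  obtain ⟨rfl, -⟩ := hc₁
  have hc₂ := hs₂.controls
  rw [hposL] at hc₂
  obtain ⟨hadjL, rfl⟩ := hc₂
  -- The stack just before stopping, together with the last vertex, is closed under parents.
  have hclosed : ∀ x ∈ {x | x = P.lastVert vR k ∨ x ∈ u₂ :: l₂}, x ≠ vR →
      P.G.Adj x (P.parentVert vR k x) ∧
        P.parentVert vR k x ∈ {x | x = P.lastVert vR k ∨ x ∈ u₂ :: l₂} := by
    intro x hx hxR
    by_cases hxL : x = P.lastVert vR k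
    · subst hxL
      rw [PortedGraph.parentVert, hparL, Function.update_self, P.dest_port hadjL]
      exact ⟨hadjL, Or.inr (by simp)⟩
    · have h := hs₂.isStack.parent_mem_tail x (hx.resolve_left hxL) hxR
      rw [PortedGraph.parentVert, hparL, Function.update_of_ne hxL]
      exact ⟨h.1, Or.inr (List.mem_of_mem_tail h.2)⟩
  have hwS : w = P.lastVert vR k ∨ w ∈ u₂ :: l₂ :=
    hpw.reverse.support_subset_of_parent_closed hG (fun x hx hxR => (hclosed x hx hxR).2)
      (Or.inl rfl) w (by simpa using hwmem)
  have hadjw : P.G.Adj w u₁ := hvw ▸ (hclosed w hwS hwR).1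
  -- The forward move out of `v` arrives at `w`, so `w` is visited from then on.
  have hwt : w ∈ (P.trace vR t').vis := by
    have hstep := P.step_pos_of_exitEvent vR hleave
    rw [P.dest_port hadjw.symm] at hstep
    obtain ⟨t, rfl⟩ : ∃ m, t = m + 1 := ⟨t - 1, by omega⟩
    exact (P.trace_extends vR htt').1 (P.mem_step_vis vR (s := P.trace vR (t + 1)) hstep)
  have hwL : w ≠ P.lastVert vR k := fun h => hL (h ▸ (P.trace_extends vR htT').1 hwt)
  have hw₁ : w ∈ u₁ :: l₁ := hback w (hwS.resolve_left hwL) hwt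
  have hpar : P.dest w ((P.trace vR t').par w) = u₁ := by
    rw [← (P.trace_extends vR htT').2 w hwt]
    rw [PortedGraph.parentVert, hparL, Function.update_of_ne hwL] at hvw
    exact hvw.symm
  exact hs₁.isStack.head_notMem (hpar ▸ (hs₁.isStack.parent_mem_tail w hw₁ hwR).2)
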